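/- There do not exist points p, q₁, q₂, q₃, q₄, q₅, q₆ in the Euclidean plane ℝ² such that dist(p, qᵢ) ≤ 2 for all 1 ≤ i ≤ 6 and dist(qᵢ, qⱼ) > 2 for all 1 ≤ i < j ≤ 6. Equivalently, the star K_{1,6} is not a unit disk graph: a unit disk (radius 1) cannot intersect six pairwise non-intersecting unit disks. -/

import Mathlib

/-- Two complex numbers of norm at most `2` and more than `2` apart subtend an angle greater
than `π / 3` at the origin. -/
theorem Complex.cos_arg_sub_arg_lt_half {z w : ℂ} (hz : ‖z‖ ≤ 2) (hw : ‖w‖ ≤ 2)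
    (h : 2 < ‖z - w‖) : Real.cos (z.arg - w.arg) < 1 / 2 := by
  have hz0 : 0 < ‖z‖ := by linarith [norm_sub_le z w]
  have hw0 : 0 < ‖w‖ := by linarith [norm_sub_le z w]
  have key : ‖z - w‖ ^ 2 =
      ‖z‖ ^ 2 + ‖w‖ ^ 2 - 2 * (‖z‖ * ‖w‖ * Real.cos (z.arg - w.arg)) := by
    have hinner : ‖z‖ * ‖w‖ * Real.cos (z.arg - w.arg) = z.re * w.re + z.im * w.im := by
      rw [Real.cos_sub, ← Complex.norm_mul_cos_arg z, ← Complex.norm_mul_cos_arg w,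
        ← Complex.norm_mul_sin_arg z, ← Complex.norm_mul_sin_arg w]
      ring
    rw [hinner, Complex.sq_norm, Complex.sq_norm, Complex.sq_norm, Complex.normSq_apply,
      Complex.normSq_apply, Complex.normSq_apply, Complex.sub_re, Complex.sub_im]
    ring
  have hmax : ‖z‖ ^ 2 + ‖w‖ ^ 2 - ‖z‖ * ‖w‖ ≤ 4 := by
    rcases le_total ‖z‖ ‖w‖ with hle | hle <;> nlinarith
  by_contra! hcos
  nlinarith [mul_le_mul_of_nonneg_left hcos (mul_pos hz0 hw0).le]

theorem Real.half_le_cos_of_abs_le_pi_div_three {x : ℝ} (hx : |x| ≤ Real.pi / 3) :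
    1 / 2 ≤ Real.cos x := by
  rw [← Real.cos_pi_div_three, ← Real.cos_abs x]
  exact Real.cos_le_cos_of_nonneg_of_le_pi (abs_nonneg x) (by linarith [Real.pi_pos]) hx

/-- There are no six real numbers in `(-π, π]`, one of them zero, that are pairwise more than
`π / 3` apart as angles. -/
theorem exists_half_le_cos_sub (θ : Fin 6 → ℝ) (h0 : θ 0 = 0)
    (hlo : ∀ i, -Real.pi < θ i) (hhi : ∀ i, θ i ≤ Real.pi) :
    ∃ i j, i ≠ j ∧ 1 / 2 ≤ Real.cos (θ i - θ j) := by
  by_contra! hsep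
  have hclose : ∀ i j, i ≠ j → Real.pi / 3 < |θ i - θ j| := fun i j hij ↦ by
    by_contra! hle
    exact (hsep i j hij).not_ge (Real.half_le_cos_of_abs_le_pi_div_three hle)
  let sector : Fin 5 → Fin 4 := fun i ↦
    if 2 * Real.pi / 3 < θ i.succ then 0
    else if 0 < θ i.succ then 1
    else if θ i.succ ≤ -(2 * Real.pi / 3) then 2 else 3
  obtain ⟨i, j, hij, heq⟩ := Fintype.exists_ne_map_eq_of_card_lt sector (by simp)
  have hd := hclose i.succ j.succ (by simpa using hij)
  have hi := hclose i.succ 0 (Fin.succ_ne_zero i)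
  have hj := hclose j.succ 0 (Fin.succ_ne_zero j)
  rw [h0, sub_zero] at hi hj
  have := hlo i.succ
  have := hlo j.succ
  have := hhi i.succ
  have := hhi j.succ
  dsimp only [sector] at heq
  rw [lt_abs] at hd hi hj
  split_ifs at heq <;>
    first
    | exact absurd heq (by decide)
    | (rcases hd with hd | hd <;> rcases hi with hi | hi <;> rcases hj with hj | hj <;> linarith)

/-- No six points of the closed disk of radius `2` in the complex plane are pairwise more than
`2` apart. -/
theorem Complex.exists_norm_sub_le_two (z : Fin 6 → ℂ) (hz : ∀ i, ‖z i‖ ≤ 2) :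
    ∃ i j, i ≠ j ∧ ‖z i - z j‖ ≤ 2 := by
  by_contra! hsep
  have hz0 : z 0 ≠ 0 := fun h ↦ by
    have := hsep 1 0 (by decide)
    rw [h, sub_zero] at this
    exact this.not_ge (hz 1)
  have hn : (‖z 0‖ : ℝ) ≠ 0 := norm_ne_zero_iff.mpr hz0
  let u : ℂ := ‖z 0‖ / z 0
  have hu : ‖u‖ = 1 := by simp [u, hn]
  have harg : (z 0 * u).arg = 0 := by
    rw [mul_div_cancel₀ _ hz0]
    exact Complex.arg_ofReal_of_nonneg (norm_nonneg _)
  obtain ⟨i, j, hij, hcos⟩ := exists_half_le_cos_sub (fun i ↦ (z i * u).arg) harg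
    (fun i ↦ Complex.neg_pi_lt_arg _) (fun i ↦ Complex.arg_le_pi _)
  refine hcos.not_gt (Complex.cos_arg_sub_arg_lt_half ?_ ?_ ?_)
  · simpa [hu] using hz i
  · simpa [hu] using hz j
  · simpa [← sub_mul, hu] using hsep i j hij

/-- The star `K_{1,6}` is not a unit disk graph: there is no point `p` in the plane
together with six points `q i`, each within distance 2 of `p`, that are pairwise at
distance greater than 2 from each other. -/
theorem no_K16_unit_disk_representation :
    ¬ ∃ (p : EuclideanSpace ℝ (Fin 2)) (q : Fin 6 → EuclideanSpace ℝ (Fin 2)),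
      (∀ i, dist p (q i) ≤ 2) ∧ (∀ i j, i ≠ j → 2 < dist (q i) (q j)) := by
  rintro ⟨p, q, hp, hq⟩
  let e := Complex.orthonormalBasisOneI.repr.symm
  obtain ⟨i, j, hij, hle⟩ := Complex.exists_norm_sub_le_two (fun i ↦ e (q i - p)) fun i ↦ by
    rw [e.norm_map, ← dist_eq_norm, dist_comm]
    exact hp i
  rw [← map_sub, e.norm_map, sub_sub_sub_cancel_right, ← dist_eq_norm] at hle
  exact hle.not_gt (hq i j hij)
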